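/- Let u be a real number with 0 < u < log((3+√5)/2), ξ := u + 2π√-1, and w₀ := (φ(u) + 2π√-1)/ξ. Then the second derivative of Φ at w₀ equals d²Φ/dw²(w₀) = ξ·√((e^u+e^{-u}+1)(e^u+e^{-u}-3)), where the square root of the negative real number (e^u+e^{-u}+1)(e^u+e^{-u}-3) is the positive multiple of √-1. -/

import Mathlib

open Complex MeasureTheory Filter Topology Finset

noncomputable section

/-- The dilogarithm `Li₂(z) = -∫₀^z log(1-x)/x dx` along the segment from `0` to `z`. -/
def dilog (z : ℂ) : ℂ := -∫ t in (0:ℝ)..1, Complex.log (1 - (t:ℂ) * z) / (t:ℂ)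

/-- Colored Jones polynomial of the figure-eight knot (Habiro–Le formula). -/
def JE (N : ℕ) (q : ℂ) : ℂ :=
  ∑ k ∈ Finset.range N, ∏ l ∈ Finset.Icc 1 k,
    ((q ^ (((N:ℂ) - (l:ℂ))/2) - q ^ (-(((N:ℂ) - (l:ℂ))/2))) *
     (q ^ (((N:ℂ) + (l:ℂ))/2) - q ^ (-(((N:ℂ) + (l:ℂ))/2))))

/-- Integral over the contour `C_R = (-∞,-R] ∪ Ω_R ∪ [R,∞)`, where `Ω_R` is the upper
semicircle of radius `R` traversed from `-R` to `R`. -/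
def contourCR (R : ℝ) (f : ℂ → ℂ) : ℂ :=
  (∫ t in Set.Iic (-R), f (t:ℂ)) +
  (∫ s in (0:ℝ)..Real.pi,
      f ((R:ℂ) * Complex.exp (Complex.I * ((Real.pi:ℂ) - (s:ℂ)))) *
        (-Complex.I * (R:ℂ) * Complex.exp (Complex.I * ((Real.pi:ℂ) - (s:ℂ))))) +
  (∫ t in Set.Ici R, f (t:ℂ))

/-- Faddeev's quantum dilogarithm `S_γ(z)`. -/
def Sqd (γ : ℂ) (R : ℝ) (z : ℂ) : ℂ :=
  Complex.exp ((1/4) * contourCR R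
    (fun t => Complex.exp (z * t) / (Complex.sinh ((Real.pi:ℂ) * t) * Complex.sinh (γ * t) * t)))

/-- The square root of `(e^u+e^{-u}+1)(e^u+e^{-u}-3)` chosen as a positive multiple of `√-1`. -/
def betaRoot (u : ℝ) : ℂ :=
  Complex.I * (Real.sqrt (-((Real.exp u + Real.exp (-u) + 1) * (Real.exp u + Real.exp (-u) - 3))) : ℝ)

/-- `φ(u) = arccosh(cosh u - 1/2)` with the branch described in the paper. -/
def phiu (u : ℝ) : ℂ :=
  Complex.log (((Real.exp u + Real.exp (-u) - 1 : ℝ) - betaRoot u) / 2)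

/-- `S(u) = Li₂(e^{u-φ(u)}) - Li₂(e^{u+φ(u)}) - uφ(u)`. -/
def Su (u : ℝ) : ℂ :=
  dilog (Complex.exp ((u:ℂ) - phiu u)) - dilog (Complex.exp ((u:ℂ) + phiu u)) - (u:ℂ) * phiu u

/-- `Φ(w) = (1/ξ)(Li₂(e^{u-ξw}) - Li₂(e^{u+ξw})) - uw` with `ξ = u + 2π√-1`. -/
def Phi (u : ℝ) (w : ℂ) : ℂ :=
  (1/((u:ℂ) + 2*(Real.pi:ℂ)*Complex.I)) *
    (dilog (Complex.exp ((u:ℂ) - ((u:ℂ) + 2*(Real.pi:ℂ)*Complex.I) * w)) -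
     dilog (Complex.exp ((u:ℂ) + ((u:ℂ) + 2*(Real.pi:ℂ)*Complex.I) * w))) - (u:ℂ) * w

/-- `g_N(w) = e^{-Nuw} S_γ(π-√-1u+√-1ξw)/S_γ(-π-√-1u-√-1ξw)`, `γ = (2π-√-1u)/(2N)`. -/
def gN (u : ℝ) (N : ℕ) (R : ℝ) (w : ℂ) : ℂ :=
  Complex.exp (-(N:ℂ) * (u:ℂ) * w) *
    Sqd ((2*(Real.pi:ℂ) - Complex.I*(u:ℂ))/(2*(N:ℂ))) R
      ((Real.pi:ℂ) - Complex.I*(u:ℂ) + Complex.I*((u:ℂ) + 2*(Real.pi:ℂ)*Complex.I)*w) /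
    Sqd ((2*(Real.pi:ℂ) - Complex.I*(u:ℂ))/(2*(N:ℂ))) R
      (-(Real.pi:ℂ) - Complex.I*(u:ℂ) - Complex.I*((u:ℂ) + 2*(Real.pi:ℂ)*Complex.I)*w)

/-- Integral of `f` along the straight segment from `a` to `b`. -/
def segInt (f : ℂ → ℂ) (a b : ℂ) : ℂ :=
  ∫ t in (0:ℝ)..1, f (a + (t:ℂ) * (b - a)) * (b - a)

/-- Integral of `f` along the polygonal line through the given list of vertices. -/
def polyInt (f : ℂ → ℂ) : List ℂ → ℂ
  | a :: b :: rest => segInt f a b + polyInt f (b :: rest)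
  | _ => 0

/-- Vertices of the polygonal line `C_+(ε)`. -/
def Cplus (u ε : ℝ) : List ℂ :=
  [((1 - ε : ℝ) : ℂ),
   ((1 - u/(2*Real.pi) - ε : ℝ) : ℂ) + Complex.I,
   ((-(u/(2*Real.pi)) + ε : ℝ) : ℂ) + Complex.I,
   ((ε : ℝ) : ℂ)]

/-- Vertices of the polygonal line `C_-(ε)`. -/
def Cminus (u ε : ℝ) : List ℂ :=
  [((ε : ℝ) : ℂ),
   ((u/(2*Real.pi) : ℝ) : ℂ) - Complex.I,
   ((1 + u/(2*Real.pi) : ℝ) : ℂ) - Complex.I,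
   ((1 - ε : ℝ) : ℂ)]

/-- `I_γ(z)` from Andersen–Hansen. -/
def Iqd (γ : ℂ) (R : ℝ) (z : ℂ) : ℂ :=
  (1/4) * contourCR R
    (fun t => Complex.exp (z * t) / (t * Complex.sinh ((Real.pi:ℂ) * t)) *
      (1/Complex.sinh (γ * t) - 1/(γ * t)))

end

theorem one_sub_mul_mem_slitPlane {z : ℂ} (hz : 1 - z ∈ slitPlane) {t : ℝ}
    (ht : t ∈ Set.Icc (0 : ℝ) 1) : 1 - (t : ℂ) * z ∈ slitPlane := by
  have h := starConvex_one_slitPlane hz (sub_nonneg.2 ht.2) ht.1 (by ring)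
  have e : (1 - t) • (1 : ℂ) + t • (1 - z) = 1 - (t : ℂ) * z := by
    simp only [real_smul]; push_cast; ring
  rwa [e] at h

theorem intervalIntegrable_log_one_sub_mul_div {z : ℂ} (hz : 1 - z ∈ slitPlane) :
    IntervalIntegrable (fun t : ℝ => Complex.log (1 - (t : ℂ) * z) / (t : ℂ)) volume 0 1 := by
  have hd : ∀ t ∈ Set.Icc (0 : ℝ) 1,
      HasDerivAt (fun t : ℂ => Complex.log (1 - t * z)) (-z / (1 - (t : ℂ) * z)) (t : ℂ) := by
    intro t ht
    have h := (((hasDerivAt_id (t : ℂ)).mul_const z).const_sub 1).clog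
      (one_sub_mul_mem_slitPlane hz ht)
    simpa using h
  have hc : ContinuousOn (fun t : ℝ => dslope (fun t : ℂ => Complex.log (1 - t * z)) 0 (t : ℂ))
      (Set.uIcc 0 1) := by
    rw [Set.uIcc_of_le zero_le_one]
    intro t ht
    refine ContinuousAt.continuousWithinAt (ContinuousAt.comp
      (g := dslope (fun t : ℂ => Complex.log (1 - t * z)) 0) ?_ continuous_ofReal.continuousAt)
    by_cases h0 : (t : ℂ) = 0
    · rw [h0, continuousAt_dslope_same]
      have := hd t ht
      rw [h0] at this
      exact this.differentiableAt
    · rw [continuousAt_dslope_of_ne h0]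
      exact (hd t ht).continuousAt
  refine hc.intervalIntegrable.congr_ae ?_
  refine (ae_restrict_of_ae ?_)
  filter_upwards [Measure.ae_ne volume (0 : ℝ)] with t ht
  have ht' : (t : ℂ) ≠ 0 := by exact_mod_cast ht
  rw [dslope_of_ne _ ht', slope_def_field]
  simp

/-- The dilogarithm has derivative `-log (1 - z) / z` off the cut `[1, ∞)`. -/
theorem hasDerivAt_dilog {z : ℂ} (hz : 1 - z ∈ slitPlane) (hz0 : z ≠ 0) :
    HasDerivAt dilog (-Complex.log (1 - z) / z) z := by
  have hopen : IsOpen {x : ℂ | 1 - x ∈ slitPlane} :=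
    isOpen_slitPlane.preimage (continuous_const.sub continuous_id)
  obtain ⟨r, hr, hball⟩ := Metric.nhds_basis_closedBall.mem_iff.1 (hopen.mem_nhds hz)
  have hK : IsCompact (Set.Icc (0 : ℝ) 1 ×ˢ Metric.closedBall z r) :=
    isCompact_Icc.prod (isCompact_closedBall z r)
  have hcont : ContinuousOn (fun p : ℝ × ℂ => -(1 - (p.1 : ℂ) * p.2)⁻¹)
      (Set.Icc (0 : ℝ) 1 ×ˢ Metric.closedBall z r) := by
    refine ContinuousOn.neg (ContinuousOn.inv₀ (by fun_prop) ?_)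
    rintro ⟨t, x⟩ ⟨ht, hx⟩
    exact slitPlane_ne_zero (one_sub_mul_mem_slitPlane (hball hx) ht)
  obtain ⟨C, hC⟩ := hK.exists_bound_of_continuousOn hcont
  have hI : Set.uIoc (0 : ℝ) 1 = Set.Ioc 0 1 := Set.uIoc_of_le zero_le_one
  have key := intervalIntegral.hasDerivAt_integral_of_dominated_loc_of_deriv_le
    (μ := volume) (a := 0) (b := 1) (x₀ := z) (s := Metric.closedBall z r)
    (F := fun x t => Complex.log (1 - (t : ℂ) * x) / (t : ℂ))
    (F' := fun x t => -(1 - (t : ℂ) * x)⁻¹) (bound := fun _ => C)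
    (Metric.closedBall_mem_nhds z hr)
    (Eventually.of_forall fun x => by
      apply Measurable.aestronglyMeasurable
      fun_prop)
    (intervalIntegrable_log_one_sub_mul_div hz)
    (by
      apply Measurable.aestronglyMeasurable
      fun_prop)
    (Eventually.of_forall fun t ht x hx => by
      rw [hI] at ht
      exact hC (t, x) ⟨⟨ht.1.le, ht.2⟩, hx⟩)
    intervalIntegrable_const
    (Eventually.of_forall fun t ht x hx => by
      rw [hI] at ht
      have ht0 : (t : ℂ) ≠ 0 := by exact_mod_cast ht.1.ne'
      have hs := one_sub_mul_mem_slitPlane (hball hx) ⟨ht.1.le, ht.2⟩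
      have h := ((((hasDerivAt_id x).const_mul (t : ℂ)).const_sub 1).clog hs).div_const (t : ℂ)
      refine h.congr_deriv ?_
      have := slitPlane_ne_zero hs
      simp only [id_eq]
      field_simp)
  have hlog := log_inv_eq_integral hz
  rw [Complex.log_inv _ (slitPlane_arg_ne_pi hz)] at hlog
  refine HasDerivAt.congr_deriv (f := dilog) key.2.neg ?_
  rw [intervalIntegral.integral_neg, neg_neg, hlog, mul_div_cancel_left₀ _ hz0]
  simp [real_smul]

theorem one_sub_mem_slitPlane_of_im_ne_zero {z : ℂ} (hz : z.im ≠ 0) : 1 - z ∈ slitPlane :=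
  mem_slitPlane_iff.2 <| Or.inr (by simpa using hz)

theorem hasDerivAt_Phi {u : ℝ} {w ξ : ℂ} (hξ : ξ = (u : ℂ) + 2 * (Real.pi : ℂ) * Complex.I)
    (hξ0 : ξ ≠ 0) (h₁ : (Complex.exp ((u : ℂ) - ξ * w)).im ≠ 0)
    (h₂ : (Complex.exp ((u : ℂ) + ξ * w)).im ≠ 0) :
    HasDerivAt (Phi u) (Complex.log (1 - Complex.exp ((u : ℂ) - ξ * w)) +
      Complex.log (1 - Complex.exp ((u : ℂ) + ξ * w)) - u) w := by
  have hl := (hasDerivAt_id w).const_mul ξ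
  have d₁ := (hasDerivAt_dilog (one_sub_mem_slitPlane_of_im_ne_zero h₁)
    (Complex.exp_ne_zero _)).comp w (hl.const_sub (u : ℂ)).cexp
  have d₂ := (hasDerivAt_dilog (one_sub_mem_slitPlane_of_im_ne_zero h₂)
    (Complex.exp_ne_zero _)).comp w (hl.const_add (u : ℂ)).cexp
  have h := ((d₁.sub d₂).const_mul (1 / ξ)).sub ((hasDerivAt_id w).const_mul (u : ℂ))
  have e : Phi u = fun w => (1 / ξ) * (dilog (Complex.exp ((u : ℂ) - ξ * w)) -
      dilog (Complex.exp ((u : ℂ) + ξ * w))) - (u : ℂ) * w := by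
    subst hξ; rfl
  rw [e]
  refine h.congr_deriv ?_
  have := Complex.exp_ne_zero ((u : ℂ) - ξ * w)
  have := Complex.exp_ne_zero ((u : ℂ) + ξ * w)
  simp only [id]
  field_simp
  ring

theorem hasDerivAt_deriv_Phi {u : ℝ} {w ξ : ℂ}
    (hξ : ξ = (u : ℂ) + 2 * (Real.pi : ℂ) * Complex.I)
    (hξ0 : ξ ≠ 0) (h₁ : (Complex.exp ((u : ℂ) - ξ * w)).im ≠ 0)
    (h₂ : (Complex.exp ((u : ℂ) + ξ * w)).im ≠ 0) :
    HasDerivAt (deriv (Phi u))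
      (ξ * (Complex.exp ((u : ℂ) - ξ * w) / (1 - Complex.exp ((u : ℂ) - ξ * w)) -
        Complex.exp ((u : ℂ) + ξ * w) / (1 - Complex.exp ((u : ℂ) + ξ * w)))) w := by
  have hl := (hasDerivAt_id w).const_mul ξ
  have d₁ := ((hl.const_sub (u : ℂ)).cexp.const_sub 1).clog
    (one_sub_mem_slitPlane_of_im_ne_zero h₁)
  have d₂ := ((hl.const_add (u : ℂ)).cexp.const_sub 1).clog
    (one_sub_mem_slitPlane_of_im_ne_zero h₂)
  have h := (d₁.add d₂).sub_const (u : ℂ)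
  have c₁ : Continuous fun w : ℂ => (Complex.exp ((u : ℂ) - ξ * w)).im :=
    continuous_im.comp (by fun_prop)
  have c₂ : Continuous fun w : ℂ => (Complex.exp ((u : ℂ) + ξ * w)).im :=
    continuous_im.comp (by fun_prop)
  have h' := h.congr_of_eventuallyEq (f₁ := deriv (Phi u)) (by
    filter_upwards [c₁.continuousAt.eventually_ne h₁, c₂.continuousAt.eventually_ne h₂]
      with v hv₁ hv₂
    exact (hasDerivAt_Phi hξ hξ0 hv₁ hv₂).deriv)
  refine h'.congr_deriv ?_
  simp only [id]
  ring

theorem exp_add_exp_neg_lt_three {u : ℝ} (hu0 : 0 < u)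
    (hu1 : u < Real.log ((3 + Real.sqrt 5) / 2)) : Real.exp u + Real.exp (-u) < 3 := by
  have h5 : Real.sqrt 5 ^ 2 = 5 := Real.sq_sqrt (by norm_num)
  have h5' := Real.sqrt_nonneg 5
  have h1 : 1 < Real.exp u := Real.one_lt_exp_iff.2 hu0
  have h2 : Real.exp u < (3 + Real.sqrt 5) / 2 := (Real.lt_log_iff_exp_lt (by positivity)).1 hu1
  have h3 : Real.exp u * Real.exp (-u) = 1 := by rw [← Real.exp_add]; simp
  have h4 : 2 < Real.sqrt 5 := by nlinarith
  have h6 : (Real.exp u - (3 - Real.sqrt 5) / 2) * (Real.exp u - (3 + Real.sqrt 5) / 2) < 0 :=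
    mul_neg_of_pos_of_neg (by linarith) (by linarith)
  nlinarith

/-- the second derivative of `Φ` at the saddle point `w₀` equals
`ξ√((e^u+e^{-u}+1)(e^u+e^{-u}-3))`. -/
theorem stmt10 (u : ℝ) (hu0 : 0 < u) (hu1 : u < Real.log ((3 + Real.sqrt 5)/2))
    (ξ w₀ : ℂ) (hξ : ξ = (u:ℂ) + 2*(Real.pi:ℂ)*Complex.I)
    (hw : w₀ = (phiu u + 2*(Real.pi:ℂ)*Complex.I)/ξ) :
    deriv (deriv (Phi u)) w₀ = ξ * betaRoot u := by
  have hc := exp_add_exp_neg_lt_three hu0 hu1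
  have h3 : Real.exp u * Real.exp (-u) = 1 := by rw [← Real.exp_add]; simp
  have hξ0 : ξ ≠ 0 := by
    intro h
    have := congrArg Complex.re (hξ.symm.trans h)
    simp at this
    exact hu0.ne' this
  have ha : (0 : ℝ) < Real.exp u := Real.exp_pos u
  have hb : (0 : ℝ) < Real.exp (-u) := Real.exp_pos (-u)
  have hq : (0 : ℝ) <
      -((Real.exp u + Real.exp (-u) + 1) * (Real.exp u + Real.exp (-u) - 3)) := by
    nlinarith
  set s : ℝ := Real.sqrt
    (-((Real.exp u + Real.exp (-u) + 1) * (Real.exp u + Real.exp (-u) - 3))) with hs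
  have hs0 : 0 < s := Real.sqrt_pos.2 hq
  have hs2 : s ^ 2 = -((Real.exp u + Real.exp (-u) + 1) * (Real.exp u + Real.exp (-u) - 3)) :=
    Real.sq_sqrt hq.le
  have hβ : betaRoot u = Complex.I * (s : ℂ) := rfl
  set a : ℝ := Real.exp u with ha_def
  set b : ℝ := Real.exp (-u) with hb_def
  set p : ℂ := ((a + b - 1 : ℝ) - Complex.I * (s : ℂ)) / 2 with hp
  set q : ℂ := ((a + b - 1 : ℝ) + Complex.I * (s : ℂ)) / 2 with hq_def
  have hs2' : (s : ℂ) ^ 2 = -(((a : ℂ) + b + 1) * (a + b - 3)) := by exact_mod_cast hs2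
  have hpq : p * q = 1 := by
    rw [hp, hq_def]
    push_cast
    linear_combination (-(s : ℂ) ^ 2 / 4) * Complex.I_sq + hs2' / 4
  have hp0 : p ≠ 0 := left_ne_zero_of_mul_eq_one hpq
  have hφ : Complex.exp (phiu u) = p := by
    rw [phiu, hβ]
    exact Complex.exp_log hp0
  have hξw : ξ * w₀ = phiu u + 2 * (Real.pi : ℂ) * Complex.I := by
    rw [hw, mul_div_cancel₀ _ hξ0]
  have e₂ : Complex.exp ((u : ℂ) + ξ * w₀) = a * p := by
    rw [hξw, Complex.exp_add, Complex.exp_add, hφ, Complex.exp_two_pi_mul_I, mul_one,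
      ha_def, Complex.ofReal_exp]
  have e₁ : Complex.exp ((u : ℂ) - ξ * w₀) = a * q := by
    rw [hξw, Complex.exp_sub, Complex.exp_add, hφ, Complex.exp_two_pi_mul_I, mul_one,
      ha_def, Complex.ofReal_exp, div_eq_iff hp0, mul_assoc, mul_comm q, hpq, mul_one]
  have i₁ : (Complex.exp ((u : ℂ) - ξ * w₀)).im ≠ 0 := by
    rw [e₁, hq_def]
    simp [ha.ne', hs0.ne']
  have i₂ : (Complex.exp ((u : ℂ) + ξ * w₀)).im ≠ 0 := by
    rw [e₂, hp]
    simp [ha.ne', hs0.ne']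
  rw [(hasDerivAt_deriv_Phi hξ hξ0 i₁ i₂).deriv, hβ]
  have n₁ := slitPlane_ne_zero (one_sub_mem_slitPlane_of_im_ne_zero i₁)
  have n₂ := slitPlane_ne_zero (one_sub_mem_slitPlane_of_im_ne_zero i₂)
  rw [e₁] at n₁ ⊢
  rw [e₂] at n₂ ⊢
  have hab : (a : ℂ) * b = 1 := by exact_mod_cast h3
  have hd : (1 - (a : ℂ) * q) * (1 - a * p) = a := by
    have hsum : p + q = (a : ℂ) + b - 1 := by
      rw [hp, hq_def]; push_cast; ring
    linear_combination (a : ℂ) ^ 2 * hpq - a * hsum - hab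
  have hdiff : q - p = Complex.I * s := by
    rw [hp, hq_def]; ring
  congr 1
  rw [div_sub_div _ _ n₁ n₂, hd, div_eq_iff (by exact_mod_cast ha.ne')]
  linear_combination (a : ℂ) * hdiff
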